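/- (Lemma C.2) Assume additionally that p₀₁ ≤ p₁₁. Then the value function attains its minimum over the belief range at one of the two post-observation beliefs with empty queue: for every q ∈ ℤ≥0 and every b ∈ [p₀₁, p₁₁], one has min( J(0, p₀₁), J(0, p₁₁) ) ≤ J(q, b). Equivalently, the relative value h(q,b) := J(q,b) − min( J(0,p₀₁), J(0,p₁₁) ) is nonnegative on ℤ≥0 × [p₀₁, p₁₁]. -/

import Mathlib

open Finset Filter Topology

noncomputable section

/-- Belief update map `𝒯(b) = b·p₁₁ + (1−b)·p₀₁`. -/
def beliefT (p01 p11 b : ℝ) : ℝ := b * p11 + (1 - b) * p01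

/-- Queue update `𝒬⁺(q,a,d) = max(0, q−d) + a` (via truncated `ℕ` subtraction). -/
def Qplus (q a d : ℕ) : ℕ := (q - d) + a

/-- One-step Bellman cost `J̃(q,b;u)` of action `u` given continuation value `Jprev`. -/
def Jtilde (Ma : ℕ) (p : ℕ → ℝ) (p01 p11 β κ : ℝ) (c : ℕ → ℝ)
    (Jprev : ℕ → ℝ → ℝ) (q : ℕ) (b : ℝ) (u : ℕ) : ℝ :=
  if u = 0 then
    (q : ℝ) + β * ∑ i ∈ Finset.range (Ma + 1),
      p i * Jprev (Qplus q i 0) (beliefT p01 p11 b)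
  else
    (q : ℝ) + κ * c u + β * ∑ i ∈ Finset.range (Ma + 1),
      p i * (b * Jprev (Qplus q i u) p11 + (1 - b) * Jprev (Qplus q i 0) p01)

/-- Value-iteration iterates `Jₙ(q,b)`, with `J₀ ≡ 0` and
`Jₙ(q,b) = min_{u ∈ {0,…,M_d}} J̃ₙ(q,b;u)`. -/
def Jiter (Ma Md : ℕ) (p : ℕ → ℝ) (p01 p11 β κ : ℝ) (c : ℕ → ℝ) :
    ℕ → ℕ → ℝ → ℝ
  | 0 => fun _ _ => 0
  | n + 1 => fun q b =>
      (Finset.range (Md + 1)).inf' ⟨0, Finset.mem_range.mpr (Nat.succ_pos _)⟩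
        (fun u => Jtilde Ma p p01 p11 β κ c (Jiter Ma Md p p01 p11 β κ c n) q b u)

theorem beliefT_mem {p01 p11 b : ℝ} (h0 : p01 ∈ Set.Ioo (0:ℝ) 1) (h1 : p11 ∈ Set.Ioo (0:ℝ) 1)
    (hb : b ∈ Set.Icc (0:ℝ) 1) : beliefT p01 p11 b ∈ Set.Icc (0:ℝ) 1 := by
  obtain ⟨h0, h0'⟩ := h0
  obtain ⟨h1, h1'⟩ := h1
  obtain ⟨hb, hb'⟩ := hb
  unfold beliefT
  constructor
  · nlinarith [mul_nonneg hb h1.le, mul_nonneg (sub_nonneg.2 hb') h0.le]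
  · nlinarith [mul_nonneg hb (sub_nonneg.2 h1'.le),
      mul_nonneg (sub_nonneg.2 hb') (sub_nonneg.2 h0'.le)]

theorem Jiter_mono (Ma Md : ℕ) (p : ℕ → ℝ) (hp : ∀ i ≤ Ma, p i ∈ Set.Icc (0:ℝ) 1)
    (p01 p11 : ℝ) (hp01 : p01 ∈ Set.Ioo (0:ℝ) 1) (hp11 : p11 ∈ Set.Ioo (0:ℝ) 1)
    (β : ℝ) (hβ : β ∈ Set.Ioo (0:ℝ) 1) (κ : ℝ) (c : ℕ → ℝ) (n : ℕ) :
    ∀ q q' : ℕ, q ≤ q' → ∀ b ∈ Set.Icc (0:ℝ) 1,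
      Jiter Ma Md p p01 p11 β κ c n q b ≤ Jiter Ma Md p p01 p11 β κ c n q' b := by
  induction n with
  | zero => intro q q' _ b _; exact le_rfl
  | succ n ih =>
    intro q q' hq b hb
    have hqr : (q : ℝ) ≤ q' := by exact_mod_cast hq
    have hQ : ∀ i d, Qplus q i d ≤ Qplus q' i d := by
      intro i d; unfold Qplus; omega
    have hβ0 := hβ.1.le
    have hb0 := hb.1
    have hb1 : 0 ≤ 1 - b := sub_nonneg.2 hb.2
    simp only [Jiter]
    refine Finset.le_inf' _ _ fun u hu => (Finset.inf'_le _ hu).trans ?_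
    unfold Jtilde
    split_ifs
    · refine add_le_add hqr (mul_le_mul_of_nonneg_left (Finset.sum_le_sum fun i hi => ?_) hβ0)
      have hpi := (hp i (by simp at hi; omega)).1
      exact mul_le_mul_of_nonneg_left (ih _ _ (hQ _ _) _ (beliefT_mem hp01 hp11 hb)) hpi
    · refine add_le_add (add_le_add hqr le_rfl)
        (mul_le_mul_of_nonneg_left (Finset.sum_le_sum fun i hi => ?_) hβ0)
      have hpi := (hp i (by simp at hi; omega)).1
      refine mul_le_mul_of_nonneg_left (add_le_add ?_ ?_) hpi
      · exact mul_le_mul_of_nonneg_left (ih _ _ (hQ _ _) _ ⟨hp11.1.le, hp11.2.le⟩) hb0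
      · exact mul_le_mul_of_nonneg_left (ih _ _ (hQ _ _) _ ⟨hp01.1.le, hp01.2.le⟩) hb1

theorem Jiter_concave (Ma Md : ℕ) (p : ℕ → ℝ) (hp : ∀ i ≤ Ma, p i ∈ Set.Icc (0:ℝ) 1)
    (p01 p11 : ℝ) (hp01 : p01 ∈ Set.Ioo (0:ℝ) 1) (hp11 : p11 ∈ Set.Ioo (0:ℝ) 1)
    (β : ℝ) (hβ : β ∈ Set.Ioo (0:ℝ) 1) (κ : ℝ) (c : ℕ → ℝ) (n : ℕ) :
    ∀ q : ℕ, ∀ x ∈ Set.Icc (0:ℝ) 1, ∀ y ∈ Set.Icc (0:ℝ) 1, ∀ s t : ℝ, 0 ≤ s → 0 ≤ t → s + t = 1 →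
      s * Jiter Ma Md p p01 p11 β κ c n q x + t * Jiter Ma Md p p01 p11 β κ c n q y
        ≤ Jiter Ma Md p p01 p11 β κ c n q (s * x + t * y) := by
  induction n with
  | zero => intro q x _ y _ s t _ _ _; simp [Jiter]
  | succ n ih =>
    intro q x hx y hy s t hs ht hst
    obtain rfl : t = 1 - s := by linarith
    have hβ0 := hβ.1.le
    simp only [Jiter]
    refine Finset.le_inf' _ _ fun u hu => (add_le_add
      (mul_le_mul_of_nonneg_left (Finset.inf'_le _ hu) hs)
      (mul_le_mul_of_nonneg_left (Finset.inf'_le _ hu) ht)).trans ?_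
    unfold Jtilde
    generalize Jiter Ma Md p p01 p11 β κ c n = J at *
    split_ifs
    · have key : s * (∑ i ∈ Finset.range (Ma + 1), p i * J (Qplus q i 0) (beliefT p01 p11 x))
          + (1 - s) * (∑ i ∈ Finset.range (Ma + 1), p i * J (Qplus q i 0) (beliefT p01 p11 y))
          ≤ ∑ i ∈ Finset.range (Ma + 1),
            p i * J (Qplus q i 0) (beliefT p01 p11 (s * x + (1 - s) * y)) := by
        rw [Finset.mul_sum, Finset.mul_sum, ← Finset.sum_add_distrib]
        refine Finset.sum_le_sum fun i hi => ?_
        have hpi := (hp i (by simp at hi; omega)).1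
        have h := mul_le_mul_of_nonneg_left (ih (Qplus q i 0) _ (beliefT_mem hp01 hp11 hx) _
          (beliefT_mem hp01 hp11 hy) s (1 - s) hs ht hst) hpi
        have e : s * beliefT p01 p11 x + (1 - s) * beliefT p01 p11 y
            = beliefT p01 p11 (s * x + (1 - s) * y) := by unfold beliefT; ring
        rw [e] at h
        linarith
      have := mul_le_mul_of_nonneg_left key hβ0
      linarith
    · have key : s * (∑ i ∈ Finset.range (Ma + 1),
            p i * (x * J (Qplus q i u) p11 + (1 - x) * J (Qplus q i 0) p01))
          + (1 - s) * (∑ i ∈ Finset.range (Ma + 1),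
            p i * (y * J (Qplus q i u) p11 + (1 - y) * J (Qplus q i 0) p01))
          = ∑ i ∈ Finset.range (Ma + 1),
            p i * ((s * x + (1 - s) * y) * J (Qplus q i u) p11
              + (1 - (s * x + (1 - s) * y)) * J (Qplus q i 0) p01) := by
        rw [Finset.mul_sum, Finset.mul_sum, ← Finset.sum_add_distrib]
        exact Finset.sum_congr rfl fun i _ => by ring
      rw [← key]
      apply le_of_eq
      ring

theorem stmt14
    (Ma Md : ℕ) (hMa : 1 ≤ Ma) (hMd : 1 ≤ Md)
    (p : ℕ → ℝ) (hp : ∀ i ≤ Ma, p i ∈ Set.Icc (0:ℝ) 1)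
    (hpsum : ∑ i ∈ Finset.range (Ma + 1), p i = 1)
    (p01 p11 : ℝ) (hp01 : p01 ∈ Set.Ioo (0:ℝ) 1) (hp11 : p11 ∈ Set.Ioo (0:ℝ) 1)
    (β : ℝ) (hβ : β ∈ Set.Ioo (0:ℝ) 1)
    (κ : ℝ) (hκ : 0 < κ)
    (c : ℕ → ℝ) (hc0 : c 0 = 0) (hcnn : ∀ u ≤ Md, 0 ≤ c u)
    (hcmono : ∀ u v : ℕ, u < v → v ≤ Md → c u < c v)
    (Jlim : ℕ → ℝ → ℝ)
    (hJlim : ∀ (q : ℕ), ∀ b ∈ Set.Icc (0:ℝ) 1,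
      Tendsto (fun n => Jiter Ma Md p p01 p11 β κ c n q b) atTop (𝓝 (Jlim q b)))
    (hple : p01 ≤ p11) :
    ∀ (q : ℕ), ∀ b ∈ Set.Icc p01 p11,
      min (Jlim 0 p01) (Jlim 0 p11) ≤ Jlim q b := by
  intro q b hb
  have m0 : p01 ∈ Set.Icc (0:ℝ) 1 := ⟨hp01.1.le, hp01.2.le⟩
  have m1 : p11 ∈ Set.Icc (0:ℝ) 1 := ⟨hp11.1.le, hp11.2.le⟩
  have mb : b ∈ Set.Icc (0:ℝ) 1 := ⟨m0.1.trans hb.1, hb.2.trans m1.2⟩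
  refine le_of_tendsto_of_tendsto' ((hJlim 0 p01 m0).min (hJlim 0 p11 m1)) (hJlim q b mb) ?_
  intro n
  refine le_trans ?_ (Jiter_mono Ma Md p hp p01 p11 hp01 hp11 β hβ κ c n 0 q (Nat.zero_le _) b mb)
  have hseg : b ∈ segment ℝ p01 p11 := by rw [segment_eq_Icc hple]; exact hb
  obtain ⟨s, t, hs, ht, hst, rfl⟩ := hseg
  refine le_trans ?_ (Jiter_concave Ma Md p hp p01 p11 hp01 hp11 β hβ κ c n 0 p01 m0 p11 m1
    s t hs ht hst)
  generalize Jiter Ma Md p p01 p11 β κ c n 0 p01 = A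
  generalize Jiter Ma Md p p01 p11 β κ c n 0 p11 = B
  have h1 := mul_le_mul_of_nonneg_left (min_le_left A B) hs
  have h2 := mul_le_mul_of_nonneg_left (min_le_right A B) ht
  have h3 : min A B = s * min A B + t * min A B := by rw [← add_mul, hst, one_mul]
  linarith
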